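/- arXiv:1205.4674 — 3 statements merged into one kernel-verified Lean document; each statement's English description precedes it below -/
import Mathlib

section
/- Let h : [0,1] → ℝ be a concave function and fix z ∈ [0,1]. Then the function (δ,γ) ↦ H_b(1/2 + (δ-γ)/2) + δ + γ - 1 + ((1+δ-γ)/2)·h(1 + (δ-z)/(1+δ-γ)) + ((1-δ+γ)/2)·h((1-z-γ)/(1+γ-δ)) is concave on the convex set {(δ,γ) : 0 ≤ δ ≤ z, 0 ≤ γ ≤ 1-z}, where a term whose coefficient (1+δ-γ)/2 or (1-δ+γ)/2 vanishes is interpreted as 0. -/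
/-- The binary entropy function (base-2), with the convention `0 · log 0 = 0`. -/
noncomputable def binEnt (x : ℝ) : ℝ :=
  -(x * Real.logb 2 x) - (1 - x) * Real.logb 2 (1 - x)

theorem ConcaveOn.perspective_le {h : ℝ → ℝ} (hconc : ConcaveOn ℝ (Set.Icc (0 : ℝ) 1) h)
    {u₁ v₁ u₂ v₂ a b : ℝ} (hu₁ : 0 ≤ u₁) (huv₁ : u₁ ≤ v₁) (hu₂ : 0 ≤ u₂) (huv₂ : u₂ ≤ v₂)
    (ha : 0 ≤ a) (hb : 0 ≤ b) :
    a * (v₁ * h (u₁ / v₁)) + b * (v₂ * h (u₂ / v₂)) ≤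
      (a * v₁ + b * v₂) * h ((a * u₁ + b * u₂) / (a * v₁ + b * v₂)) := by
  have hv₁ : 0 ≤ v₁ := hu₁.trans huv₁
  have hv₂ : 0 ≤ v₂ := hu₂.trans huv₂
  have hav : 0 ≤ a * v₁ := mul_nonneg ha hv₁
  have hbv : 0 ≤ b * v₂ := mul_nonneg hb hv₂
  rcases (add_nonneg hav hbv).eq_or_lt with hV | hV
  · have h₁ : a * v₁ = 0 := by linarith
    have h₂ : b * v₂ = 0 := by linarith
    rw [← mul_assoc, ← mul_assoc, h₁, h₂]
    simp
  · have cancel : ∀ {u v : ℝ}, 0 ≤ u → u ≤ v → v * (u / v) = u := fun {u v} hu huv =>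
      mul_div_cancel_of_imp' fun hv => le_antisymm (hv ▸ huv) hu
    have key := hconc.2 ⟨div_nonneg hu₁ hv₁, div_le_one_of_le₀ huv₁ hv₁⟩
      ⟨div_nonneg hu₂ hv₂, div_le_one_of_le₀ huv₂ hv₂⟩
      (div_nonneg hav hV.le) (div_nonneg hbv hV.le)
      (by rw [← add_div, div_self hV.ne'])
    simp only [smul_eq_mul] at key
    have harg : a * v₁ / (a * v₁ + b * v₂) * (u₁ / v₁) + b * v₂ / (a * v₁ + b * v₂) * (u₂ / v₂)
        = (a * u₁ + b * u₂) / (a * v₁ + b * v₂) := by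
      rw [div_mul_eq_mul_div, div_mul_eq_mul_div, ← add_div, mul_assoc, mul_assoc,
        cancel hu₁ huv₁, cancel hu₂ huv₂]
    rw [harg, div_mul_eq_mul_div, div_mul_eq_mul_div, ← add_div, div_le_iff₀ hV] at key
    linarith

theorem binEnt_eq_binEntropy_div (x : ℝ) : binEnt x = Real.binEntropy x / Real.log 2 := by
  rw [binEnt, Real.binEntropy_eq_negMulLog_add_negMulLog_one_sub]
  simp only [Real.negMulLog, Real.logb]
  ring

theorem concaveOn_binEnt : ConcaveOn ℝ (Set.Icc (0 : ℝ) 1) binEnt := by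
  have h := Real.strictConcave_binEntropy.concaveOn.smul
    (inv_nonneg.2 (Real.log_nonneg one_le_two))
  refine h.congr fun x _ => ?_
  simp only [smul_eq_mul, binEnt_eq_binEntropy_div]
  ring

theorem mul_apply_one_add_div (h : ℝ → ℝ) (u v : ℝ) :
    v * h (1 + u / v) = v * h ((v + u) / v) := by
  rcases eq_or_ne v 0 with rfl | hv
  · simp
  · rw [add_div, div_self hv]

/- Note: in Lean, division by zero yields zero, so when a coefficient
`(1+δ-γ)/2` (resp. `(1-δ+γ)/2`) vanishes the corresponding term is
automatically `0 * h 1 = 0` (resp. `0 * h 0 = 0`), matching the stated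
convention. -/
theorem bellman_objective_concave (h : ℝ → ℝ)
    (hconc : ConcaveOn ℝ (Set.Icc (0 : ℝ) 1) h)
    (z : ℝ) (hz : z ∈ Set.Icc (0 : ℝ) 1) :
    ConcaveOn ℝ (Set.Icc (0 : ℝ) z ×ˢ Set.Icc (0 : ℝ) (1 - z))
      (fun p : ℝ × ℝ =>
        binEnt (1 / 2 + (p.1 - p.2) / 2) + p.1 + p.2 - 1
          + ((1 + p.1 - p.2) / 2) * h (1 + (p.1 - z) / (1 + p.1 - p.2))
          + ((1 - p.1 + p.2) / 2) * h ((1 - z - p.2) / (1 + p.2 - p.1))) := by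
  refine ⟨(convex_Icc _ _).prod (convex_Icc _ _), ?_⟩
  rintro ⟨x₁, y₁⟩ ⟨⟨hx₁, hxz₁⟩, hy₁, hyz₁⟩ ⟨x₂, y₂⟩ ⟨⟨hx₂, hxz₂⟩, hy₂, hyz₂⟩ a b ha hb hab
  obtain ⟨hz₀, hz₁⟩ := hz
  dsimp only at hx₁ hxz₁ hy₁ hyz₁ hx₂ hxz₂ hy₂ hyz₂
  simp only [smul_eq_mul, Prod.smul_mk, Prod.mk_add_mk]
  obtain rfl : b = 1 - a := by linarith
  have entropy := concaveOn_binEnt.2 (x := 1 / 2 + (x₁ - y₁) / 2) (y := 1 / 2 + (x₂ - y₂) / 2)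
    ⟨by linarith, by linarith⟩ ⟨by linarith, by linarith⟩ ha hb hab
  have left := hconc.perspective_le (u₁ := 1 + x₁ - y₁ + (x₁ - z)) (v₁ := 1 + x₁ - y₁)
    (u₂ := 1 + x₂ - y₂ + (x₂ - z)) (v₂ := 1 + x₂ - y₂)
    (by linarith) (by linarith) (by linarith) (by linarith) ha hb
  have right := hconc.perspective_le (u₁ := 1 - z - y₁) (v₁ := 1 + y₁ - x₁)
    (u₂ := 1 - z - y₂) (v₂ := 1 + y₂ - x₂)
    (by linarith) (by linarith) (by linarith) (by linarith) ha hb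
  simp only [smul_eq_mul] at entropy
  rw [show a * (1 / 2 + (x₁ - y₁) / 2) + (1 - a) * (1 / 2 + (x₂ - y₂) / 2)
    = 1 / 2 + (a * x₁ + (1 - a) * x₂ - (a * y₁ + (1 - a) * y₂)) / 2 by ring] at entropy
  rw [show a * (1 + x₁ - y₁ + (x₁ - z)) + (1 - a) * (1 + x₂ - y₂ + (x₂ - z))
      = 1 + (a * x₁ + (1 - a) * x₂) - (a * y₁ + (1 - a) * y₂)
        + (a * x₁ + (1 - a) * x₂ - z) by ring,
    show a * (1 + x₁ - y₁) + (1 - a) * (1 + x₂ - y₂)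
      = 1 + (a * x₁ + (1 - a) * x₂) - (a * y₁ + (1 - a) * y₂) by ring,
    ← mul_apply_one_add_div, ← mul_apply_one_add_div, ← mul_apply_one_add_div] at left
  rw [show a * (1 - z - y₁) + (1 - a) * (1 - z - y₂)
      = 1 - z - (a * y₁ + (1 - a) * y₂) by ring,
    show a * (1 + y₁ - x₁) + (1 - a) * (1 + y₂ - x₂)
      = 1 + (a * y₁ + (1 - a) * y₂) - (a * x₁ + (1 - a) * x₂) by ring] at right
  linarith
end

section
/- For every z ∈ [2a/(1+a), 1], the identity g_z(a(2-z), 1-z) = h*(z) + ρ holds; i.e., the Bellman-operator expression evaluated at the policy δ = a(2-z), γ = 1-z equals h*(z) + ρ on the right interval. -/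
/-- The right-interval branch of the function `h*` solving the Bellman equation. -/
noncomputable def Bbranch (a ρ z : ℝ) : ℝ :=
  (1 / (1 - a)) * binEnt ((2 * a + (1 - a) * z) / 2) - z
    + ((a * z - 4 * a - z) / (2 * (1 - a))) * ρ
    + ((2 * a + (1 - a) * z) / (2 * (1 - a))) * binEnt (2 * a / (a * (2 - z) + z))

/-- The function `h*` solving the Bellman equation: `h*(z) = H_b(z)` on
`[(1-a)/(1+a), 2a/(1+a)]`, the branch `Bbranch` on `[2a/(1+a), 1]`, and
`h*(z) = h*(1-z)` on `[0, (1-a)/(1+a)]` (where `1-z ∈ [2a/(1+a), 1]`). -/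
noncomputable def hStar (a ρ z : ℝ) : ℝ :=
  if z < (1 - a) / (1 + a) then Bbranch a ρ (1 - z)
  else if z ≤ 2 * a / (1 + a) then binEnt z
  else Bbranch a ρ z

/-- The Bellman-operator objective `g_z(δ, γ)` (restricted to the policy `(δ, γ)`),
for the function `h*`. Since division by zero is zero in Lean, any term whose
coefficient vanishes is automatically `0`, matching the stated convention. -/
noncomputable def gObj (a ρ z δ γ : ℝ) : ℝ :=
  binEnt (1 / 2 + (δ - γ) / 2) + δ + γ - 1
    + ((1 + δ - γ) / 2) * hStar a ρ (1 + (δ - z) / (1 + δ - γ))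
    + ((1 - δ + γ) / 2) * hStar a ρ ((1 - z - γ) / (1 + γ - δ))

/-- Chain rule for the entropy of the distribution `(a, (1 - a) / 2, (1 - a) / 2)`. -/
theorem binEnt_chain {a : ℝ} (h0 : 0 < a) (h1 : a < 1) :
    binEnt ((1 + a) / 2) + (1 + a) / 2 * binEnt (2 * a / (1 + a)) = binEnt a + (1 - a) := by
  have hp : (1 + a) ≠ 0 := by positivity
  have hm : (1 - a) ≠ 0 := by linarith
  have e1 : 1 - (1 + a) / 2 = (1 - a) / 2 := by ring
  have e2 : 1 - 2 * a / (1 + a) = (1 - a) / (1 + a) := by field_simp; ring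
  have two : Real.logb 2 2 = 1 := Real.logb_self_eq_one (by norm_num)
  unfold binEnt
  rw [e1, e2, Real.logb_div hp two_ne_zero, Real.logb_div hm two_ne_zero,
    Real.logb_div (by positivity) hp, Real.logb_div hm hp, Real.logb_mul two_ne_zero h0.ne', two]
  field_simp
  ring

/-- The optimal gain `ρ` is the value of the right branch at `1`. -/
theorem Bbranch_one {a : ℝ} (h0 : 0 < a) (h1 : a < 1) :
    Bbranch a (2 * binEnt a / (3 + a)) 1 = 2 * binEnt a / (3 + a) := by
  have hm : (1 - a) ≠ 0 := by linarith
  have h3 : (3 + a) ≠ 0 := by positivity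
  have hc := binEnt_chain h0 h1
  unfold Bbranch
  rw [show (2 * a + (1 - a) * 1) / 2 = (1 + a) / 2 by ring,
    show a * (2 - 1) + 1 = 1 + a by ring, eq_sub_of_add_eq hc]
  field_simp
  ring

/-- The two formulas defining `h*` agree at the breakpoint `2a / (1 + a)`. -/
theorem Bbranch_breakpoint {a : ℝ} (h0 : 0 < a) (h1 : a < 1) :
    Bbranch a (2 * binEnt a / (3 + a)) (2 * a / (1 + a)) = binEnt (2 * a / (1 + a)) := by
  have hp : (1 + a) ≠ 0 := by positivity
  have hm : (1 - a) ≠ 0 := by linarith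
  have h3 : (3 + a) ≠ 0 := by positivity
  have hc := binEnt_chain h0 h1
  have e1 : (2 * a + (1 - a) * (2 * a / (1 + a))) / 2 = 2 * a / (1 + a) := by field_simp; ring
  have e2 : 2 * a / (a * (2 - 2 * a / (1 + a)) + 2 * a / (1 + a)) = (1 + a) / 2 := by
    rw [show a * (2 - 2 * a / (1 + a)) + 2 * a / (1 + a) = 4 * a / (1 + a) by field_simp; ring]
    field_simp
    norm_num
  unfold Bbranch
  rw [e1, e2, eq_sub_of_add_eq hc]
  field_simp
  ring

/-- On the whole closed right interval, `h*` is given by its right branch. -/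
theorem hStar_eq_Bbranch {a z : ℝ} (h0 : 1 / 3 ≤ a) (h1 : a < 1) (hz : 2 * a / (1 + a) ≤ z) :
    hStar a (2 * binEnt a / (3 + a)) z = Bbranch a (2 * binEnt a / (3 + a)) z := by
  have hle : (1 - a) / (1 + a) ≤ 2 * a / (1 + a) := by gcongr; linarith
  unfold hStar
  rw [if_neg (by linarith)]
  split_ifs with h
  · obtain rfl := le_antisymm h hz
    exact (Bbranch_breakpoint (by linarith) h1).symm
  · rfl

theorem hStar_zero {a : ℝ} (h0 : 0 < a) (h1 : a < 1) :
    hStar a (2 * binEnt a / (3 + a)) 0 = 2 * binEnt a / (3 + a) := by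
  have hpos : 0 < (1 - a) / (1 + a) := div_pos (by linarith) (by linarith)
  rw [hStar, if_pos hpos, sub_zero, Bbranch_one h0 h1]

theorem bellman_right_interval (a : ℝ) (ha : a ∈ Set.Ioo (0 : ℝ) 1)
    (haroot : a ^ 4 - 5 * a ^ 3 + 6 * a ^ 2 - 4 * a + 1 = 0)
    (hauniq : ∀ x ∈ Set.Ioo (0 : ℝ) 1,
      x ^ 4 - 5 * x ^ 3 + 6 * x ^ 2 - 4 * x + 1 = 0 → x = a) :
    ∀ z ∈ Set.Icc (2 * a / (1 + a)) 1,
      gObj a (2 * binEnt a / (3 + a)) z (a * (2 - z)) (1 - z)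
        = hStar a (2 * binEnt a / (3 + a)) z + 2 * binEnt a / (3 + a) := by
  rintro z ⟨hz, hz1⟩
  obtain ⟨h0, h1⟩ := ha
  have h3 : 1 / 3 ≤ a := by
    by_contra! h
    have : a ^ 3 < (1 / 3) ^ 3 := by gcongr
    have : (2 / 3 : ℝ) ^ 4 < (1 - a) ^ 4 := by gcongr; linarith
    linarith
  have hm : (1 - a) ≠ 0 := by linarith
  have hs : 0 < 2 * a + (1 - a) * z := by
    have : 0 ≤ z := le_trans (by positivity) hz
    nlinarith
  have hw : 1 + (a * (2 - z) - z) / (1 + a * (2 - z) - (1 - z))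
      = 2 * a * (2 - z) / (2 * a + (1 - a) * z) := by
    rw [show 1 + a * (2 - z) - (1 - z) = 2 * a + (1 - a) * z by ring,
      one_add_div hs.ne']
    congr 1
    ring
  have hwle : 2 * a / (1 + a) ≤ 2 * a * (2 - z) / (2 * a + (1 - a) * z) := by
    rw [div_le_div_iff₀ (by linarith) hs]
    nlinarith
  rw [gObj, hw, show 1 - z - (1 - z) = 0 by ring, zero_div, hStar_zero h0 h1,
    hStar_eq_Bbranch h3 h1 hwle, hStar_eq_Bbranch h3 h1 hz]
  generalize 2 * binEnt a / (3 + a) = ρ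
  unfold Bbranch
  rw [show a * (2 - z) + z = 2 * a + (1 - a) * z by ring,
    show 1 / 2 + (a * (2 - z) - (1 - z)) / 2 = (2 * a + (1 - a) * z) / 2 by ring]
  obtain ⟨s, hsz⟩ : ∃ s, s = 2 * a + (1 - a) * z := ⟨_, rfl⟩
  rw [← hsz] at hs ⊢
  have e1 : (2 * a + (1 - a) * (2 * a * (2 - z) / s)) / 2 = 2 * a / s := by
    field_simp
    rw [hsz]
    ring
  have e2 : 2 * a / (a * (2 - 2 * a * (2 - z) / s) + 2 * a * (2 - z) / s) = s / 2 := by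
    rw [show a * (2 - 2 * a * (2 - z) / s) + 2 * a * (2 - z) / s = 4 * a / s by
      field_simp
      rw [hsz]
      ring]
    field_simp
    norm_num
  have e3 : 2 * a + (1 - a) * (2 * a * (2 - z) / s) = 4 * a / s := by linear_combination 2 * e1
  rw [e1, e2, e3]
  generalize binEnt (s / 2) = X
  generalize binEnt (2 * a / s) = Y
  field_simp
  rw [hsz]
  ring
end

section
/- Let a be the unique root in (0,1) of the polynomial x⁴ - 5x³ + 6x² - 4x + 1. Then the maximum of the coding-rate function q ↦ 2H_b(q)/(4-q) over q ∈ [0,1] is attained at q = 1-a, and the maximum value equals 2H_b(a)/(3+a); i.e., the coding scheme that sends data with alternation probability q = 1-a achieves the feedback capacity of the Ising channel. -/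
/-- The one-term Gibbs inequality. -/
theorem neg_mul_log_le {x y : ℝ} (hx : 0 ≤ x) (hy : 0 < y) :
    -(x * Real.log x) ≤ -(x * Real.log y) + (y - x) := by
  rcases hx.eq_or_lt with rfl | hx
  · simpa using hy.le
  · have h := mul_le_mul_of_nonneg_left (Real.log_le_sub_one_of_pos (div_pos hy hx)) hx.le
    rw [Real.log_div hy.ne' hx.ne', mul_sub, mul_sub, mul_div_cancel₀ _ hx.ne'] at h
    linarith

theorem binEnt_eq_div (x : ℝ) :
    binEnt x = (-(x * Real.log x) - (1 - x) * Real.log (1 - x)) / Real.log 2 := by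
  simp only [binEnt, Real.logb]
  ring

theorem binEnt_one_sub (x : ℝ) : binEnt (1 - x) = binEnt x := by
  simp only [binEnt, sub_sub_cancel]
  ring

theorem coding_rate_maximized (a : ℝ) (ha : a ∈ Set.Ioo (0 : ℝ) 1)
    (haroot : a ^ 4 - 5 * a ^ 3 + 6 * a ^ 2 - 4 * a + 1 = 0)
    (hauniq : ∀ x ∈ Set.Ioo (0 : ℝ) 1,
      x ^ 4 - 5 * x ^ 3 + 6 * x ^ 2 - 4 * x + 1 = 0 → x = a) :
    (∀ q ∈ Set.Icc (0 : ℝ) 1, 2 * binEnt q / (4 - q) ≤ 2 * binEnt a / (3 + a)) ∧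
      2 * binEnt (1 - a) / (4 - (1 - a)) = 2 * binEnt a / (3 + a) := by
  obtain ⟨ha0, ha1⟩ := ha
  have hlog : 4 * Real.log (1 - a) = 3 * Real.log a := by
    have h : (1 - a) ^ 4 = a ^ 3 := by linear_combination haroot
    simpa using congrArg Real.log h
  have hl2 : 0 < Real.log 2 := Real.log_pos one_lt_two
  refine ⟨fun q ⟨hq0, hq1⟩ => ?_, ?_⟩
  · have hmax : 2 * binEnt a / (3 + a) = 2 * (-(Real.log a / 4) / Real.log 2) := by
      have h3 : 3 + a ≠ 0 := by positivity
      rw [binEnt_eq_div]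
      field_simp
      linear_combination (-(1 - a)) * hlog
    rw [hmax, div_le_iff₀ (by linarith), binEnt_eq_div, mul_assoc, div_mul_eq_mul_div]
    refine mul_le_mul_of_nonneg_left (div_le_div_of_nonneg_right ?_ hl2.le) zero_le_two
    have h1 := neg_mul_log_le hq0 (sub_pos.2 ha1)
    have h2 := neg_mul_log_le (sub_nonneg.2 hq1) ha0
    have h3 : q * Real.log (1 - a) = q * (3 / 4 * Real.log a) := by
      congr 1
      linarith
    linarith
  · rw [binEnt_one_sub]
    congr 1
    ring
end
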